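/- Define the stationary density ζ_s = (1/κ)·Σ_{ρ ∈ Rec(z)} |ρ|/#V (this quantity does not depend on the choice of z) and the threshold density ζ_τ(s_0) = E_{s_0}[|s_τ|]/#V, the expected total mass per site of the threshold state. Then ζ_τ(s_0) → ζ_s as |s_0| → −∞. -/

import Mathlib

open scoped BigOperators
open Classical Filter

noncomputable section

namespace ThresholdState

variable {V : Type*} [Fintype V] [DecidableEq V]

/-- `A i j` is the number of directed edges from `i` to `j`. -/
def outdeg (A : V → V → ℕ) (i : V) : ℕ := ∑ j, A i j

def indeg (A : V → V → ℕ) (i : V) : ℕ := ∑ j, A j i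

/-- Eulerian: out-degree equals in-degree at every vertex. -/
def Eulerian (A : V → V → ℕ) : Prop := ∀ i, outdeg A i = indeg A i

/-- (Strongly) connected multigraph. -/
def Connected (A : V → V → ℕ) : Prop :=
  ∀ i j : V, Relation.ReflTransGen (fun a b => 0 < A a b) i j

def deg (A : V → V → ℕ) (i : V) : ℕ := outdeg A i

/-- Graph Laplacian: `Δu(i) = -deg(i)·u(i) + Σ_{e incoming to i} u(e⁻)`. -/
def lap (A : V → V → ℕ) (u : V → ℤ) (i : V) : ℤ :=
  -(deg A i : ℤ) * u i + ∑ j, (A j i : ℤ) * u j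

def delta (z : V) : V → ℤ := fun j => if j = z then 1 else 0

/-- Toppling vertex `i`: replace `s` by `s + Δδ_i`. -/
def toppleAt (A : V → V → ℕ) (s : V → ℤ) (i : V) : V → ℤ :=
  fun j => s j + lap A (delta i) j

def applySeq (A : V → V → ℕ) (s : V → ℤ) (l : List V) : V → ℤ :=
  l.foldl (toppleAt A) s

/-- A legal toppling sequence (avoiding the forbidden set `F`): each toppled
vertex is unstable when toppled and does not lie in `F`. -/
def ValidSeq (A : V → V → ℕ) (F : V → Prop) : (V → ℤ) → List V → Prop
  | _, [] => True
  | s, i :: l => ¬ F i ∧ (deg A i : ℤ) ≤ s i ∧ ValidSeq A F (toppleAt A s i) l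

/-- Stable at every non-forbidden vertex. -/
def StableOff (A : V → V → ℕ) (F : V → Prop) (s : V → ℤ) : Prop :=
  ∀ i, ¬ F i → s i ≤ (deg A i : ℤ) - 1

def StabilizesTo (A : V → V → ℕ) (F : V → Prop) (s : V → ℤ) (l : List V) : Prop :=
  ValidSeq A F s l ∧ StableOff A F (applySeq A s l)

def StabilizableVia (A : V → V → ℕ) (F : V → Prop) (s : V → ℤ) : Prop :=
  ∃ l, StabilizesTo A F s l

/-- Stabilizable with no forbidden vertices. -/
def Stabilizable (A : V → V → ℕ) (s : V → ℤ) : Prop :=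
  StabilizableVia A (fun _ => False) s

def stabSeq (A : V → V → ℕ) (F : V → Prop) (s : V → ℤ) : List V :=
  if h : StabilizableVia A F s then h.choose else []

def stabilizeVia (A : V → V → ℕ) (F : V → Prop) (s : V → ℤ) : V → ℤ :=
  applySeq A s (stabSeq A F s)

/-- Odometer: number of topplings at each vertex (`0` everywhere if not stabilizable). -/
def odometerVia (A : V → V → ℕ) (F : V → Prop) (s : V → ℤ) : V → ℕ :=
  fun i => (stabSeq A F s).count i

def sinkStabilize (A : V → V → ℕ) (z : V) (s : V → ℤ) : V → ℤ :=
  stabilizeVia A (fun i => i = z) s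

def sinkOdometer (A : V → V → ℕ) (z : V) (s : V → ℤ) : V → ℕ :=
  odometerVia A (fun i => i = z) s

/-- `ρ` is `z`-recurrent (Dhar's burning test): `ρ(z) = deg z`, `ρ(i) ≤ deg i - 1`
off the sink, and every site other than `z` topples exactly once in the
stabilization of `ρ + Δδ_z` with sink `z`. -/
def ZRec (A : V → V → ℕ) (z : V) (ρ : V → ℤ) : Prop :=
  ρ z = (deg A z : ℤ) ∧ (∀ i, i ≠ z → ρ i ≤ (deg A i : ℤ) - 1) ∧
  ∃ l : List V, StabilizesTo A (fun i => i = z) (fun j => ρ j + lap A (delta z) j) l ∧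
    ∀ i, i ≠ z → l.count i = 1

/-- `κ` = number of `z`-recurrent sandpiles. -/
def kappa (A : V → V → ℕ) (z : V) : ℕ := Nat.card {ρ : V → ℤ // ZRec A z ρ}

def totalMass (s : V → ℤ) : ℤ := ∑ i, s i

/-- Open addition operator `â_i` (with sink `z`). -/
def openAdd (A : V → V → ℕ) (z i : V) (ρ : V → ℤ) : V → ℤ :=
  fun j => if j = z then (deg A z : ℤ) else sinkStabilize A z (fun k => ρ k + delta i k) j

/-- `â_i⁻¹` on `Rec(z)`. -/
def openAddInv (A : V → V → ℕ) (z i : V) (ρ : V → ℤ) : V → ℤ :=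
  if h : ∃ ρ', ZRec A z ρ' ∧ openAdd A z i ρ' = ρ then h.choose else ρ

/-- Burst size `av_{i→z}(ρ) = |â_i⁻¹ρ| - |ρ| + 1`. -/
def burst (A : V → V → ℕ) (z i : V) (ρ : V → ℤ) : ℤ :=
  totalMass (openAddInv A z i ρ) - totalMass ρ + 1

/-- The `z`-recurrent decomposition `s = ρ + m·δ_z + Δv` with `ρ ∈ Rec(z)`, `v(z)=0`. -/
def ZDecomp (A : V → V → ℕ) (z : V) (s ρ : V → ℤ) (m : ℤ) (v : V → ℤ) : Prop :=
  ZRec A z ρ ∧ v z = 0 ∧ ∀ j, s j = ρ j + m * delta z j + lap A v j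

/-- `R_z(s)`: the `z`-recurrent representative of `s`. -/
def Rz (A : V → V → ℕ) (z : V) (s : V → ℤ) : V → ℤ :=
  if h : ∃ ρ, ∃ m, ∃ v, ZDecomp A z s ρ m v then h.choose else s

/-- `m_z(s)`: the integer in the `z`-recurrent decomposition of `s`. -/
def mz (A : V → V → ℕ) (z : V) (s : V → ℤ) : ℤ :=
  if h : ∃ m, ∃ ρ, ∃ v, ZDecomp A z s ρ m v then h.choose else 0

/-- Closed addition operator `a_i`. -/
def closedAdd (A : V → V → ℕ) (i : V) (s : V → ℤ) : V → ℤ :=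
  if Stabilizable A (fun j => s j + delta i j) then
    stabilizeVia A (fun _ => False) (fun j => s j + delta i j)
  else fun j => s j + delta i j

/-- The closed chain after making the additions listed in `w` (in order). -/
def chain (A : V → V → ℕ) (s0 : V → ℤ) (w : List V) : V → ℤ :=
  w.foldl (fun s i => closedAdd A i s) s0

/-- `w` is a threshold word for `s0`: the chain first becomes non-stabilizable
exactly after the additions in `w`, i.e. `τ = |w|` on the cylinder of `w`. -/
def IsThresholdWord (A : V → V → ℕ) (s0 : V → ℤ) (w : List V) : Prop :=
  ¬ Stabilizable A (chain A s0 w) ∧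
  ∀ w' : List V, w' <+: w → w' ≠ w → Stabilizable A (chain A s0 w')

def wordProb (α : V → ℝ) (w : List V) : ℝ := (w.map α).prod

/-- `P_{s0}(E at the threshold time)`: total probability of the (disjoint)
cylinders of threshold words satisfying `E`. -/
def thresholdProb (A : V → V → ℕ) (α : V → ℝ) (s0 : V → ℤ) (E : List V → Prop) : ℝ :=
  ∑' w : List V, if IsThresholdWord A s0 w ∧ E w then wordProb α w else 0

/-- `E_{s0}[f at the threshold time]`. -/
def thresholdExp (A : V → V → ℕ) (α : V → ℝ) (s0 : V → ℤ) (f : List V → ℝ) : ℝ :=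
  ∑' w : List V, if IsThresholdWord A s0 w then wordProb α w * f w else 0

set_option linter.unusedSectionVars false

/-! ### The Laplacian -/

/-- The Laplacian as a homomorphism of additive groups. -/
def lapHom (A : V → V → ℕ) : (V → ℤ) →+ (V → ℤ) where
  toFun := lap A
  map_zero' := by ext i; simp [lap]
  map_add' u v := by
    ext i
    simp only [lap, Pi.add_apply, mul_add, Finset.sum_add_distrib]
    ring

theorem lap_add (A : V → V → ℕ) (u v : V → ℤ) (i : V) :
    lap A (u + v) i = lap A u i + lap A v i :=
  congrFun ((lapHom A).map_add u v) i

theorem lap_sub (A : V → V → ℕ) (u v : V → ℤ) (i : V) :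
    lap A (u - v) i = lap A u i - lap A v i :=
  congrFun ((lapHom A).map_sub u v) i

theorem lap_neg (A : V → V → ℕ) (u : V → ℤ) (i : V) : lap A (-u) i = -lap A u i :=
  congrFun ((lapHom A).map_neg u) i

theorem lap_zero (A : V → V → ℕ) (i : V) : lap A 0 i = 0 :=
  congrFun (lapHom A).map_zero i

theorem lap_zsmul (A : V → V → ℕ) (n : ℤ) (u : V → ℤ) (i : V) :
    lap A (n • u) i = n * lap A u i := by
  have := congrFun (map_zsmul (lapHom A) n u) i
  rwa [Pi.smul_apply, smul_eq_mul] at this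

theorem lap_const {A : V → V → ℕ} (hEul : Eulerian A) (c : ℤ) (i : V) :
    lap A (fun _ => c) i = 0 := by
  have h : (deg A i : ℤ) = ∑ j, (A j i : ℤ) := by
    have := hEul i
    unfold deg
    rw [this, indeg]
    push_cast
    rfl
  simp only [lap, ← Finset.sum_mul, h]
  ring

theorem lap_add_const {A : V → V → ℕ} (hEul : Eulerian A) (u : V → ℤ) (c : ℤ) (i : V) :
    lap A (fun j => u j + c) i = lap A u i := by
  have := lap_add A u (fun _ => c) i
  rw [lap_const hEul, add_zero] at this
  exact this

theorem totalMass_add (s t : V → ℤ) : totalMass (s + t) = totalMass s + totalMass t := by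
  simp [totalMass, Finset.sum_add_distrib]

theorem totalMass_lap (A : V → V → ℕ) (u : V → ℤ) : totalMass (lap A u) = 0 := by
  simp only [totalMass, lap, Finset.sum_add_distrib]
  rw [Finset.sum_comm, ← Finset.sum_add_distrib]
  refine Finset.sum_eq_zero fun j _ => ?_
  rw [← Finset.sum_mul, deg, outdeg]
  push_cast
  ring

theorem totalMass_delta (i : V) : totalMass (delta i) = 1 := by
  simp [totalMass, delta]

/-- A nonnegative function vanishing at `i` has nonnegative Laplacian there. -/
theorem lap_nonneg_of_eq_zero {A : V → V → ℕ} {u : V → ℤ} (hu : ∀ j, 0 ≤ u j) {i : V}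
    (hi : u i = 0) : 0 ≤ lap A u i := by
  simp only [lap, hi, mul_zero, zero_add]
  exact Finset.sum_nonneg fun j _ => mul_nonneg (by positivity) (hu j)

/-- The Laplacian is nonnegative at a minimum. -/
theorem lap_nonneg_of_isMin {A : V → V → ℕ} (hEul : Eulerian A) {u : V → ℤ} {i : V}
    (hi : ∀ j, u i ≤ u j) : 0 ≤ lap A u i := by
  rw [← lap_add_const hEul u (-u i)]
  exact lap_nonneg_of_eq_zero (fun j => by linarith [hi j]) (by ring)

theorem exists_isMin [Nonempty V] (u : V → ℤ) : ∃ i, ∀ j, u i ≤ u j :=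
  Finite.exists_min u

/-! ### Toppling sequences and the least action principle -/

theorem applySeq_eq (A : V → V → ℕ) (s : V → ℤ) (l : List V) :
    applySeq A s l = s + lap A (fun j => (l.count j : ℤ)) := by
  induction l generalizing s with
  | nil =>
    ext j
    simp only [applySeq, List.foldl_nil, List.count_nil, Pi.add_apply]
    have := lap_zero A j
    simp only [Pi.zero_def] at this
    simp [this]
  | cons i l ih =>
    have h : applySeq A s (i :: l) = applySeq A (toppleAt A s i) l := rfl
    have hc : (fun j => ((i :: l).count j : ℤ)) = delta i + fun j => (l.count j : ℤ) := by
      ext j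
      by_cases hj : j = i
      · subst hj; simp [delta, add_comm]
      · simp [delta, hj, List.count_cons_of_ne (Ne.symm hj)]
    rw [h, ih, hc]
    ext j
    simp only [Pi.add_apply, toppleAt, lap_add]
    ring

theorem ValidSeq.notMem {A : V → V → ℕ} {F : V → Prop} {l : List V} {s : V → ℤ}
    (hl : ValidSeq A F s l) {i : V} (hi : F i) : i ∉ l := by
  induction l generalizing s with
  | nil => simp
  | cons k l ih =>
    obtain ⟨hk, -, hl⟩ := hl
    simp only [List.mem_cons, not_or]
    exact ⟨fun h => hk (h ▸ hi), ih hl⟩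

theorem one_le_of_unstable {A : V → V → ℕ} {s u : V → ℤ} (hu : ∀ j, 0 ≤ u j) {i : V}
    (hi : (deg A i : ℤ) ≤ s i) (hs : s i + lap A u i ≤ (deg A i : ℤ) - 1) : 1 ≤ u i := by
  by_contra h
  have := lap_nonneg_of_eq_zero (A := A) hu (i := i) (by linarith [hu i])
  linarith

theorem sub_delta_nonneg {u : V → ℤ} (hu : ∀ j, 0 ≤ u j) {i : V} (hi : 1 ≤ u i) (j : V) :
    0 ≤ (u - delta i) j := by
  by_cases hj : j = i
  · subst hj; simp [delta, hi]
  · simp [delta, hj, hu j]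

theorem toppleAt_add_lap (A : V → V → ℕ) (s u : V → ℤ) (i j : V) :
    toppleAt A s i j + lap A (u - delta i) j = s j + lap A u j := by
  simp only [toppleAt, lap_sub]
  ring

/-- **Least action principle.** -/
theorem count_le_of_stable {A : V → V → ℕ} {F : V → Prop} {l : List V} {s u : V → ℤ}
    (hl : ValidSeq A F s l) (hu : ∀ j, 0 ≤ u j)
    (hs : ∀ i, ¬ F i → s i + lap A u i ≤ (deg A i : ℤ) - 1) (j : V) :
    (l.count j : ℤ) ≤ u j := by
  induction l generalizing s u with
  | nil => simpa using hu j
  | cons i l ih =>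
    obtain ⟨hF, hi, hl⟩ := hl
    have h := ih hl (u := u - delta i)
      (sub_delta_nonneg hu (one_le_of_unstable hu hi (hs i hF)))
      (fun k hk => by rw [toppleAt_add_lap]; exact hs k hk)
    by_cases hj : j = i
    · subst hj
      simp [delta] at h ⊢
      linarith
    · simpa [delta, hj, List.count_cons_of_ne (Ne.symm hj)] using h

theorem exists_stabilizesTo {A : V → V → ℕ} {F : V → Prop} {s u : V → ℤ}
    (hu : ∀ j, 0 ≤ u j) (hs : ∀ i, ¬ F i → s i + lap A u i ≤ (deg A i : ℤ) - 1) :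
    ∃ l, StabilizesTo A F s l := by
  obtain ⟨n, hn⟩ : ∃ n : ℕ, totalMass u = n :=
    Int.eq_ofNat_of_zero_le (Finset.sum_nonneg fun j _ => hu j)
  induction n generalizing s u with
  | zero =>
    refine ⟨[], trivial, fun i hi => ?_⟩
    have hu0 : u = 0 := by
      ext j
      exact (Finset.sum_eq_zero_iff_of_nonneg fun j _ => hu j).1 (by simpa [totalMass] using hn)
        j (Finset.mem_univ j)
    have := hs i hi
    rw [hu0, lap_zero] at this
    simpa [applySeq] using this
  | succ n ih =>
    by_cases hst : StableOff A F s
    · exact ⟨[], trivial, hst⟩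
    · simp only [StableOff, not_forall, not_le] at hst
      obtain ⟨i, hF, hi⟩ := hst
      have hi' : (deg A i : ℤ) ≤ s i := by linarith
      obtain ⟨l, hl, hl'⟩ := ih (s := toppleAt A s i) (u := u - delta i)
        (sub_delta_nonneg hu (one_le_of_unstable hu hi' (hs i hF)))
        (fun k hk => by rw [toppleAt_add_lap]; exact hs k hk) (by
          have := totalMass_add (u - delta i) (delta i)
          rw [sub_add_cancel, totalMass_delta, hn] at this
          push_cast at this
          linarith)
      exact ⟨i :: l, ⟨hF, hi', hl⟩, hl'⟩

theorem stabilizable_iff {A : V → V → ℕ} (hEul : Eulerian A) (s : V → ℤ) :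
    Stabilizable A s ↔ ∃ u : V → ℤ, ∀ i, s i + lap A u i ≤ (deg A i : ℤ) - 1 := by
  constructor
  · rintro ⟨l, -, hl⟩
    refine ⟨fun j => (l.count j : ℤ), fun i => ?_⟩
    have := hl i not_false
    rwa [applySeq_eq] at this
  · rintro ⟨u, hu⟩
    refine exists_stabilizesTo (u := fun j => u j + ∑ k, |u k|) (fun j => ?_) fun i _ => ?_
    · have := Finset.single_le_sum (f := fun k => |u k|) (fun k _ => abs_nonneg _)
        (Finset.mem_univ j)
      have h2 := neg_abs_le (u j)
      linarith
    · rw [lap_add_const hEul]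
      exact hu i

theorem stabilizable_add_lap_iff {A : V → V → ℕ} (hEul : Eulerian A) (s v : V → ℤ) :
    Stabilizable A (s + lap A v) ↔ Stabilizable A s := by
  rw [stabilizable_iff hEul, stabilizable_iff hEul]
  constructor
  · rintro ⟨u, hu⟩
    refine ⟨v + u, fun i => ?_⟩
    have := hu i
    simp only [Pi.add_apply] at this
    rw [lap_add]
    linarith
  · rintro ⟨u, hu⟩
    refine ⟨u - v, fun i => ?_⟩
    have := hu i
    simp only [Pi.add_apply]
    rw [lap_sub]
    linarith

theorem Stabilizable.mono {A : V → V → ℕ} (hEul : Eulerian A) {s t : V → ℤ}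
    (ht : Stabilizable A t) (hst : ∀ i, s i ≤ t i) : Stabilizable A s := by
  rw [stabilizable_iff hEul] at ht ⊢
  obtain ⟨u, hu⟩ := ht
  exact ⟨u, fun i => by linarith [hu i, hst i]⟩

theorem closedAdd_eq (A : V → V → ℕ) (i : V) (s : V → ℤ) :
    ∃ v, closedAdd A i s = s + delta i + lap A v := by
  unfold closedAdd
  split_ifs
  · exact ⟨_, applySeq_eq A _ _⟩
  · refine ⟨0, ?_⟩
    ext j
    simp [lap_zero]

/-! ### Recurrent sandpiles -/

/-- Starting from `z`, every other vertex is reached after a vertex of smaller level. -/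
theorem exists_level {A : V → V → ℕ} (hConn : Connected A) (z : V) :
    ∃ d : V → ℕ, ∀ i, i ≠ z → ∃ j, 0 < A j i ∧ d j < d i := by
  let R : ℕ → V → Prop := fun n => Nat.rec (fun i => i = z) (fun _ P i => ∃ j, P j ∧ 0 < A j i) n
  have hR : ∀ i, ∃ n, R n i := by
    intro i
    induction hConn z i with
    | refl => exact ⟨0, rfl⟩
    | tail _ hbc ih =>
      obtain ⟨n, hn⟩ := ih
      exact ⟨n + 1, _, hn, hbc⟩
  refine ⟨fun i => sInf {n | R n i}, fun i hi => ?_⟩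
  obtain ⟨n, hn⟩ : ∃ n, sInf {n | R n i} = n := ⟨_, rfl⟩
  have hspec : R (sInf {n | R n i}) i := Nat.sInf_mem (hR i)
  rw [hn] at hspec
  cases n with
  | zero => exact absurd hspec hi
  | succ n =>
    obtain ⟨j, hj, hA⟩ := hspec
    refine ⟨j, hA, ?_⟩
    beta_reduce
    rw [hn]
    exact Nat.lt_succ_of_le (Nat.sInf_le hj)

/-- There is a function whose Laplacian is negative off `z`. -/
theorem exists_lap_neg {A : V → V → ℕ} (hConn : Connected A) (z : V) :
    ∃ g : V → ℤ, ∀ i, i ≠ z → lap A g i ≤ -1 := by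
  obtain ⟨d, hd⟩ := exists_level hConn z
  let B : ℤ := ∑ i, (deg A i : ℤ) + 2
  let n : ℕ := ∑ i, d i
  have hB : ∀ i, (deg A i : ℤ) + 2 ≤ B := fun i => by
    have := Finset.single_le_sum (f := fun i => (deg A i : ℤ)) (fun k _ => by positivity)
        (Finset.mem_univ i)
    simpa [B] using this
  have hn : ∀ i, d i ≤ n := fun i =>
    Finset.single_le_sum (f := d) (fun k _ => Nat.zero_le _) (Finset.mem_univ i)
  refine ⟨fun i => -B ^ (n - d i), fun i hi => ?_⟩
  obtain ⟨j, hA, hj⟩ := hd i hi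
  have hB1 : 1 ≤ B := by linarith [hB i, Int.natCast_nonneg (deg A i)]
  have hpos : ∀ k : ℕ, 1 ≤ B ^ k := fun k => one_le_pow₀ hB1
  have hle : ∑ k, (A k i : ℤ) * -B ^ (n - d k) ≤ (A j i : ℤ) * -B ^ (n - d j) := by
    rw [← Finset.add_sum_erase _ _ (Finset.mem_univ j)]
    have : ∑ k ∈ Finset.univ.erase j, (A k i : ℤ) * -B ^ (n - d k) ≤ 0 :=
      Finset.sum_nonpos fun k _ => by
        have h1 := hpos (n - d k)
        have h2 : (0 : ℤ) ≤ A k i := by positivity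
        nlinarith
    linarith
  have hpow : B * B ^ (n - d i) ≤ B ^ (n - d j) := by
    rw [← pow_succ']
    exact pow_le_pow_right₀ hB1 (by have := hn i; omega)
  have hA' : (1 : ℤ) ≤ A j i := by exact_mod_cast hA
  have h3 : (A j i : ℤ) * -B ^ (n - d j) ≤ -(B * B ^ (n - d i)) := by
    nlinarith [hpos (n - d j)]
  simp only [lap]
  nlinarith [hpos (n - d i), hB i]

/-- `v` vanishes at `z` and toppling `s` according to `v` gives a sandpile stable off `z`. -/
def SinkStable (A : V → V → ℕ) (z : V) (s v : V → ℤ) : Prop :=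
  v z = 0 ∧ ∀ i, i ≠ z → s i + lap A v i ≤ (deg A i : ℤ) - 1

theorem exists_lap_lt {A : V → V → ℕ} (hEul : Eulerian A) (hConn : Connected A) (z : V)
    (s : V → ℤ) : ∃ v : V → ℤ, v z = 0 ∧ ∀ i, i ≠ z → s i + lap A v i ≤ -1 := by
  obtain ⟨g, hg⟩ := exists_lap_neg hConn z
  let N : ℤ := ∑ k, |s k| + 1
  refine ⟨fun j => (N • g) j + -(N • g) z, by simp, fun i hi => ?_⟩
  rw [lap_add_const hEul, lap_zsmul]
  have h1 := Finset.single_le_sum (f := fun k => |s k|) (fun k _ => abs_nonneg _)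
    (Finset.mem_univ i)
  have h2 := le_abs_self (s i)
  have h3 : 0 ≤ ∑ k, |s k| := Finset.sum_nonneg fun k _ => abs_nonneg _
  have h4 := hg i hi
  nlinarith

theorem exists_sinkStable_min {A : V → V → ℕ} (hEul : Eulerian A) (hConn : Connected A) (z : V)
    (s : V → ℤ) :
    ∃ v, SinkStable A z s v ∧ ∀ w, SinkStable A z s w → totalMass v ≤ totalMass w := by
  have : Nonempty V := ⟨z⟩
  obtain ⟨v₀, hv₀z, hv₀⟩ := exists_lap_lt hEul hConn z s
  have hne : ∃ n v, SinkStable A z s v ∧ totalMass v = n :=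
    ⟨_, v₀, ⟨hv₀z, fun i hi => by linarith [hv₀ i hi, Int.natCast_nonneg (deg A i)]⟩, rfl⟩
  obtain ⟨f, hfz, hf⟩ := exists_lap_lt hEul hConn z (fun i => (deg A i : ℤ) - s i)
  have hbdd : ∀ n, (∃ v, SinkStable A z s v ∧ totalMass v = n) → totalMass (-f) ≤ n := by
    rintro _ ⟨v, ⟨hvz, hv⟩, rfl⟩
    obtain ⟨i, hi⟩ := exists_isMin (v + f)
    have hiz : i = z := by
      by_contra hiz
      have h1 := lap_nonneg_of_isMin hEul hi
      rw [lap_add] at h1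
      have := hv i hiz
      have := hf i hiz
      linarith
    refine Finset.sum_le_sum fun j _ => ?_
    have := hi j
    simp only [hiz, Pi.add_apply, hvz, hfz] at this
    simp only [Pi.neg_apply]
    linarith
  obtain ⟨m, ⟨v, hv, rfl⟩, hmin⟩ := Int.exists_least_of_bdd ⟨_, hbdd⟩ hne
  exact ⟨v, hv, fun w hw => hmin _ ⟨w, hw, rfl⟩⟩

/-- Every sandpile has a `z`-recurrent decomposition. -/
theorem exists_zDecomp {A : V → V → ℕ} (hEul : Eulerian A) (hConn : Connected A) (z : V)
    (s : V → ℤ) : ∃ ρ m v, ZDecomp A z s ρ m v := by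
  obtain ⟨v, ⟨hvz, hv⟩, hmin⟩ := exists_sinkStable_min hEul hConn z s
  let m : ℤ := s z + lap A v z - deg A z
  let ρ : V → ℤ := fun j => s j + lap A v j - m * delta z j
  have hρz : ρ z = deg A z := by simp [ρ, m, delta]
  have hρ : ∀ i, i ≠ z → ρ i = s i + lap A v i := fun i hi => by simp [ρ, delta, hi]
  refine ⟨ρ, m, -v, ⟨hρz, fun i hi => by rw [hρ i hi]; exact hv i hi, ?_⟩, by simp [hvz],
    fun j => by rw [lap_neg]; simp only [ρ]; ring⟩
  let e : V → ℤ := fun j => 1 - delta z j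
  have he0 : ∀ j, 0 ≤ e j := fun j => by simp only [e, delta]; split_ifs <;> simp
  have he : ∀ j, lap A (delta z) j + lap A e j = 0 := fun j => by
    rw [← lap_add, ← lap_const hEul 1 j]
    congr 1
    ext k
    simp [e]
  have hst : ∀ i, ¬ i = z → ρ i + lap A (delta z) i + lap A e i ≤ (deg A i : ℤ) - 1 := by
    intro i hi
    rw [add_assoc, he, add_zero, hρ i hi]
    exact hv i hi
  obtain ⟨l, hl, hl'⟩ := exists_stabilizesTo (F := fun i => i = z)
    (s := fun j => ρ j + lap A (delta z) j) he0 hst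
  have hle : ∀ j, (l.count j : ℤ) ≤ e j := count_le_of_stable hl he0 hst
  refine ⟨l, ⟨hl, hl'⟩, ?_⟩
  have hcz : l.count z = 0 := List.count_eq_zero.2 (hl.notMem rfl)
  have hw := hmin (v + ((fun j => (l.count j : ℤ)) - e)) ⟨by simp [hvz, e, delta, hcz], fun i hi => by
    have h1 := hl' i hi
    rw [applySeq_eq] at h1
    simp only [Pi.add_apply, hρ i hi] at h1
    rw [lap_add, lap_sub]
    linarith [he i]⟩
  have hsum : ∑ j, (e j - l.count j) ≤ 0 := by
    rw [totalMass_add] at hw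
    have : totalMass ((fun j => (l.count j : ℤ)) - e) = -∑ j, (e j - l.count j) := by
      simp [totalMass]
    linarith
  intro i hi
  have h0 := (Finset.sum_eq_zero_iff_of_nonneg (fun j _ => sub_nonneg.2 (hle j))).1
    (le_antisymm hsum (Finset.sum_nonneg fun j _ => sub_nonneg.2 (hle j))) i (Finset.mem_univ i)
  simp only [e, delta, hi, if_false] at h0
  omega

theorem ZRec.nonneg_of_stable {A : V → V → ℕ} (hEul : Eulerian A) {z : V} {ρ : V → ℤ}
    (hρ : ZRec A z ρ) {w : V → ℤ} (hw : SinkStable A z ρ w) (j : V) : 0 ≤ w j := by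
  have : Nonempty V := ⟨z⟩
  obtain ⟨hwz, hw⟩ := hw
  obtain ⟨-, -, l, ⟨hl, -⟩, hcount⟩ := hρ
  obtain ⟨i, hi⟩ := exists_isMin w
  by_contra hj
  have hneg : w i ≤ -1 := by linarith [hi j]
  have hiz : i ≠ z := by rintro rfl; omega
  have h := count_le_of_stable (u := (fun j => w j + -w i) - delta z) hl
    (sub_delta_nonneg (fun j => by linarith [hi j]) (by omega))
    (fun k hk => by
      rw [lap_sub, lap_add_const hEul]
      linarith [hw k hk]) i
  rw [hcount i hiz] at h
  simp [delta, hiz] at h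

theorem ZRec.not_stabilizable {A : V → V → ℕ} (hEul : Eulerian A) {z : V} {ρ : V → ℤ}
    (hρ : ZRec A z ρ) : ¬ Stabilizable A ρ := by
  rw [stabilizable_iff hEul]
  rintro ⟨u, hu⟩
  have h := hρ.nonneg_of_stable hEul (w := fun j => u j + -u z)
    ⟨by simp, fun i _ => by rw [lap_add_const hEul]; exact hu i⟩
  have h1 := lap_nonneg_of_eq_zero (A := A) h (i := z) (by simp)
  rw [lap_add_const hEul] at h1
  have := hu z
  rw [hρ.1] at this
  linarith

theorem ZRec.eq_of_equiv {A : V → V → ℕ} (hEul : Eulerian A) {z : V} {ρ ρ' : V → ℤ}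
    (hρ : ZRec A z ρ) (hρ' : ZRec A z ρ') {m : ℤ} {v : V → ℤ}
    (h : ∀ j, ρ' j = ρ j + m * delta z j + lap A v j) : ρ' = ρ := by
  wlog hvz : v z = 0 generalizing v
  · exact this (v := fun j => v j + -v z) (fun j => by rw [lap_add_const hEul]; exact h j)
      (by simp)
  have h1 := hρ.nonneg_of_stable hEul (w := v) ⟨hvz, fun i hi => by
    have := hρ'.2.1 i hi
    rw [h i] at this
    simpa [delta, hi] using this⟩
  have h2 := hρ'.nonneg_of_stable hEul (w := -v) ⟨by simp [hvz], fun i hi => by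
    have := hρ.2.1 i hi
    rw [lap_neg, h i]
    simpa [delta, hi] using this⟩
  have hv : v = 0 := by
    ext j
    have := h2 j
    simp only [Pi.neg_apply] at this
    simp only [Pi.zero_apply]
    linarith [h1 j]
  subst hv
  have hm : m = 0 := by
    have := h z
    rw [hρ.1, hρ'.1, lap_zero] at this
    simpa [delta] using this
  ext j
  simp [h j, hm, lap_zero]

theorem ValidSeq.applySeq_nonneg {A : V → V → ℕ} {F : V → Prop} {l : List V} {s : V → ℤ}
    (hl : ValidSeq A F s l) {i : V} (hi : 0 ≤ s i ∨ i ∈ l) : 0 ≤ applySeq A s l i := by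
  induction l generalizing s with
  | nil => simpa [applySeq] using hi
  | cons k l ih =>
    obtain ⟨-, hk, hl⟩ := hl
    refine ih hl ?_
    by_cases hik : i = k
    · subst hik
      left
      have : (0 : ℤ) ≤ A i i := by positivity
      simp only [toppleAt, lap, delta]
      simp
      linarith
    · rcases hi with hi | hi
      · left
        have := lap_nonneg_of_eq_zero (A := A) (u := delta k)
          (fun j => by simp only [delta]; split_ifs <;> simp) (i := i) (by simp [delta, hik])
        simp only [toppleAt]
        linarith
      · right
        simpa [hik] using hi

theorem ZRec.nonneg {A : V → V → ℕ} (hEul : Eulerian A) {z : V} {ρ : V → ℤ}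
    (hρ : ZRec A z ρ) (i : V) : 0 ≤ ρ i := by
  obtain ⟨hz, -, l, ⟨hl, -⟩, hcount⟩ := hρ
  by_cases hi : i = z
  · rw [hi, hz]
    positivity
  · have h := hl.applySeq_nonneg (i := i)
      (Or.inr (List.count_pos_iff.1 (by rw [hcount i hi]; exact one_pos)))
    have hcz : l.count z = 0 := List.count_eq_zero.2 (hl.notMem rfl)
    rw [applySeq_eq] at h
    have hone : delta z + (fun j => (l.count j : ℤ)) = fun _ => 1 := by
      ext j
      by_cases hj : j = z
      · subst hj; simp [delta, hcz]
      · simp [delta, hj, hcount j hj]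
    have h0 := lap_const hEul 1 i
    rw [← hone, lap_add] at h0
    simp only [Pi.add_apply] at h
    linarith

theorem ZRec.le_deg {A : V → V → ℕ} {z : V} {ρ : V → ℤ}
    (hρ : ZRec A z ρ) (i : V) : ρ i ≤ deg A i := by
  by_cases hi : i = z
  · rw [hi, hρ.1]
  · linarith [hρ.2.1 i hi]

/-! ### Random walks on finite abelian groups -/

section Walk

variable {K : Type*} [AddCommGroup K]

/-- The averaging operator of the random walk with steps `g i` of probability `α i`. -/
def avgStep (α : V → ℝ) (g : V → K) : Module.End ℝ (K → ℝ) where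
  toFun f c := ∑ i, α i * f (c + g i)
  map_add' f f' := by ext c; simp [mul_add, Finset.sum_add_distrib]
  map_smul' a f := by ext c; simp [Finset.mul_sum, mul_left_comm]

theorem avgStep_apply (α : V → ℝ) (g : V → K) (f : K → ℝ) (c : K) :
    avgStep α g f c = ∑ i, α i * f (c + g i) := rfl

theorem avgStep_pow_succ_apply (α : V → ℝ) (g : V → K) (k : ℕ) (f : K → ℝ) (c : K) :
    (avgStep α g ^ (k + 1)) f c = ∑ i, α i * (avgStep α g ^ k) f (c + g i) := by
  rw [pow_succ']
  rfl

theorem avgStep_pow_const {α : V → ℝ} (hα : ∑ i, α i = 1) (g : V → K) (k : ℕ) (a : ℝ) (c : K) :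
    (avgStep α g ^ k) (fun _ => a) c = a := by
  induction k generalizing c with
  | zero => rfl
  | succ k ih => simp only [avgStep_pow_succ_apply, ih, ← Finset.sum_mul, hα, one_mul]

theorem avgStep_pow_nonneg {α : V → ℝ} (hα : ∀ i, 0 < α i) (g : V → K) (k : ℕ) {f : K → ℝ}
    (hf : ∀ c, 0 ≤ f c) (c : K) : 0 ≤ (avgStep α g ^ k) f c := by
  induction k generalizing c with
  | zero => exact hf c
  | succ k ih =>
    rw [avgStep_pow_succ_apply]
    exact Finset.sum_nonneg fun i _ => mul_nonneg (hα i).le (ih _)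

theorem sum_avgStep_pow [Fintype K] {α : V → ℝ} (hα : ∑ i, α i = 1) (g : V → K) (k : ℕ)
    (f : K → ℝ) : ∑ c, (avgStep α g ^ k) f c = ∑ c, f c := by
  induction k with
  | zero => rfl
  | succ k ih =>
    simp only [avgStep_pow_succ_apply]
    rw [Finset.sum_comm, ← ih]
    have : ∀ i, ∑ c, α i * (avgStep α g ^ k) f (c + g i)
        = α i * ∑ c, (avgStep α g ^ k) f c := fun i => by
      rw [← Finset.mul_sum]
      congr 1
      exact Equiv.sum_comp (Equiv.addRight (g i)) fun c => (avgStep α g ^ k) f c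
    simp only [this, ← Finset.sum_mul, hα, one_mul]

/-- With holding probability at least `α z`, the `k`-step averages decay at most geometrically. -/
theorem avgStep_pow_add_ge {α : V → ℝ} (hα : ∀ i, 0 < α i) {g : V → K} {z : V} (hz : g z = 0)
    (k j : ℕ) {f : K → ℝ} (hf : ∀ c, 0 ≤ f c) (c : K) :
    α z ^ j * (avgStep α g ^ k) f c ≤ (avgStep α g ^ (k + j)) f c := by
  induction j with
  | zero => simp
  | succ j ih =>
    rw [← add_assoc, avgStep_pow_succ_apply, pow_succ']
    have h1 := Finset.single_le_sum
      (f := fun i => α i * (avgStep α g ^ (k + j)) f (c + g i))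
      (fun i _ => mul_nonneg (hα i).le (avgStep_pow_nonneg hα g _ hf _)) (Finset.mem_univ z)
    simp only [hz, add_zero] at h1
    have h2 := mul_le_mul_of_nonneg_left ih (hα z).le
    linarith

/-- Displacements reached by the walk with positive probability. -/
def reachable {α : V → ℝ} (hα : ∀ i, 0 < α i) (g : V → K) : AddSubmonoid K where
  carrier := {d | ∃ k : ℕ, ∃ e : ℝ, 0 < e ∧ ∀ f : K → ℝ, (∀ c, 0 ≤ f c) →
    ∀ c, e * f (c + d) ≤ (avgStep α g ^ k) f c}
  zero_mem' := ⟨0, 1, one_pos, fun f _ c => by simp⟩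
  add_mem' := by
    rintro d d' ⟨k, e, he, h⟩ ⟨k', e', he', h'⟩
    refine ⟨k + k', e * e', mul_pos he he', fun f hf c => ?_⟩
    have h1 := h _ (avgStep_pow_nonneg hα g k' hf) c
    have h2 := mul_le_mul_of_nonneg_left (h' f hf (c + d)) he.le
    rw [pow_add, Module.End.mul_apply, mul_assoc, ← add_assoc]
    exact h2.trans h1

theorem mem_reachable {α : V → ℝ} (hα : ∀ i, 0 < α i) (g : V → K) (i : V) :
    g i ∈ reachable hα g := by
  refine ⟨1, α i, hα i, fun f hf c => ?_⟩
  rw [pow_one, avgStep_apply]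
  exact Finset.single_le_sum (f := fun i => α i * f (c + g i))
    (fun i _ => mul_nonneg (hα i).le (hf _)) (Finset.mem_univ i)

theorem reachable_eq_top [Finite K] {α : V → ℝ} (hα : ∀ i, 0 < α i) {g : V → K}
    (hg : ∀ c, ∃ n : V → ℤ, c = ∑ i, n i • g i) (d : K) : d ∈ reachable hα g := by
  obtain ⟨n, rfl⟩ := hg d
  refine sum_mem fun i _ => ?_
  have h : n i • g i ∈ AddSubmonoid.multiples (g i) :=
    mem_multiples_iff_mem_zmultiples.2 ⟨n i, rfl⟩
  obtain ⟨k, hk⟩ := h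
  rw [← hk]
  exact nsmul_mem (mem_reachable hα g i) k

/-- Doeblin minorization for the walk. -/
theorem exists_minorization [Fintype K] {α : V → ℝ} (hα : ∀ i, 0 < α i) {g : V → K} {z : V}
    (hz : g z = 0) (hg : ∀ c, ∃ n : V → ℤ, c = ∑ i, n i • g i) :
    ∃ L : ℕ, 0 < L ∧ ∃ η : ℝ, 0 < η ∧ ∀ f : K → ℝ, (∀ c, 0 ≤ f c) →
      ∀ c, η * ∑ d, f d ≤ Fintype.card K * (avgStep α g ^ L) f c := by
  have hr := fun d => reachable_eq_top hα hg d
  choose k e he h using hr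
  let L := ∑ d, k d + 1
  have hkL : ∀ d, k d ≤ L := fun d =>
    (Finset.single_le_sum (f := k) (fun _ _ => Nat.zero_le _) (Finset.mem_univ d)).trans
      (Nat.le_succ _)
  obtain ⟨d₀, hd₀⟩ := Finite.exists_min fun d => α z ^ (L - k d) * e d
  refine ⟨L, Nat.succ_pos _, α z ^ (L - k d₀) * e d₀,
    mul_pos (pow_pos (hα z) _) (he _), fun f hf c => ?_⟩
  rw [← Equiv.sum_comp (Equiv.addLeft c) f, Finset.mul_sum, Fintype.card, ← nsmul_eq_mul]
  refine Finset.sum_le_card_nsmul _ _ _ fun d _ => ?_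
  have h1 := avgStep_pow_add_ge hα hz (k d) (L - k d) hf c
  rw [Nat.add_sub_cancel' (hkL d)] at h1
  have h2 := mul_le_mul_of_nonneg_left (h d f hf c) (pow_pos (hα z) (L - k d)).le
  have h3 := mul_le_mul_of_nonneg_right (hd₀ d) (hf (c + d))
  simp only [Equiv.coe_addLeft]
  linarith

theorem avgStep_contraction [Fintype K] {α : V → ℝ} (hα1 : ∑ i, α i = 1) {g : V → K} {L : ℕ}
    {η : ℝ} (hη : ∀ f : K → ℝ, (∀ c, 0 ≤ f c) →
      ∀ c, η * ∑ d, f d ≤ Fintype.card K * (avgStep α g ^ L) f c)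
    {h : K → ℝ} (h0 : ∑ c, h c = 0) {M : ℝ} (hM : ∀ c, |h c| ≤ M) (c : K) :
    |(avgStep α g ^ L) h c| ≤ (1 - η) * M := by
  have hcard : (0 : ℝ) < Fintype.card K := by
    exact_mod_cast Fintype.card_pos_iff.2 ⟨c⟩
  have key : ∀ f : K → ℝ, ∑ c, f c = 0 → (∀ c, -M ≤ f c) →
      -((1 - η) * M) ≤ (avgStep α g ^ L) f c := by
    intro f hf0 hf
    have h1 := hη (f + fun _ => M) (fun c => by simpa using by linarith [hf c]) c
    rw [map_add] at h1
    simp only [Pi.add_apply, avgStep_pow_const hα1, Finset.sum_add_distrib, hf0,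
      Finset.sum_const, nsmul_eq_mul, Finset.card_univ, zero_add] at h1
    have h2 : (Fintype.card K : ℝ) * (η * M)
        ≤ Fintype.card K * ((avgStep α g ^ L) f c + M) := by linarith
    have := le_of_mul_le_mul_left h2 hcard
    linarith
  have h1 := key h h0 fun c => (abs_le.1 (hM c)).1
  have h2 := key (-h) (by simp [h0]) fun c => by
    simpa using (abs_le.1 (hM c)).2
  rw [map_neg, Pi.neg_apply] at h2
  exact abs_le.2 ⟨h1, by linarith⟩

/-- A lazy irreducible walk on a finite abelian group equidistributes. -/
theorem tendsto_avgStep_pow [Fintype K] {α : V → ℝ} (hα : ∀ i, 0 < α i) (hα1 : ∑ i, α i = 1)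
    {g : V → K} {z : V} (hz : g z = 0) (hg : ∀ c, ∃ n : V → ℤ, c = ∑ i, n i • g i)
    (f : K → ℝ) (c : K) :
    Tendsto (fun k => (avgStep α g ^ k) f c) atTop (nhds ((∑ d, f d) / Fintype.card K)) := by
  obtain ⟨L, hL, η, hη0, hη⟩ := exists_minorization hα hz hg
  have hcard : (0 : ℝ) < Fintype.card K := by
    exact_mod_cast Fintype.card_pos_iff.2 ⟨c⟩
  have hη1 : η ≤ 1 := by
    have := hη (fun _ => 1) (fun _ => zero_le_one) c
    rw [avgStep_pow_const hα1] at this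
    simp only [Finset.sum_const, nsmul_eq_mul, Finset.card_univ, mul_one] at this
    exact le_of_mul_le_mul_right (by linarith) hcard
  set a := (∑ d, f d) / Fintype.card K with ha
  let h : K → ℝ := f - fun _ => a
  have h0 : ∑ c, h c = 0 := by
    simp only [h, Pi.sub_apply, Finset.sum_sub_distrib, Finset.sum_const, nsmul_eq_mul,
      Finset.card_univ, ha]
    field_simp
    simp
  obtain ⟨M, hM⟩ : ∃ M, ∀ r < L, ∀ c, |(avgStep α g ^ r) h c| ≤ M := by
    refine ⟨∑ r ∈ Finset.range L, ∑ c, |(avgStep α g ^ r) h c|, fun r hr c => ?_⟩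
    refine (Finset.single_le_sum (f := fun c => |(avgStep α g ^ r) h c|)
      (fun _ _ => abs_nonneg _) (Finset.mem_univ c)).trans ?_
    exact Finset.single_le_sum (f := fun r => ∑ c, |(avgStep α g ^ r) h c|)
      (fun _ _ => Finset.sum_nonneg fun _ _ => abs_nonneg _) (Finset.mem_range.2 hr)
  have hbound : ∀ n r, r < L → ∀ c, |(avgStep α g ^ (L * n + r)) h c| ≤ (1 - η) ^ n * M := by
    intro n r hr
    induction n with
    | zero => simpa using hM r hr
    | succ n ih =>
      intro c
      have := avgStep_contraction hα1 hη
        (h := (avgStep α g ^ (L * n + r)) h) (by rw [sum_avgStep_pow hα1, h0]) ih c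
      rw [← Module.End.mul_apply, ← pow_add] at this
      rw [show L * (n + 1) + r = L + (L * n + r) by ring, pow_succ', mul_assoc]
      exact this
  have hlim : Tendsto (fun k => (1 - η) ^ (k / L) * M) atTop (nhds 0) := by
    have h1 := (tendsto_pow_atTop_nhds_zero_of_lt_one (r := 1 - η) (by linarith)
      (by linarith)).comp (Nat.tendsto_div_const_atTop hL.ne')
    simpa using h1.mul_const M
  have hh : Tendsto (fun k => (avgStep α g ^ k) h c) atTop (nhds 0) := by
    refine squeeze_zero_norm (fun k => ?_) hlim
    have := hbound (k / L) (k % L) (Nat.mod_lt _ hL) c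
    rwa [Nat.div_add_mod] at this
  have hfin := hh.add_const a
  rw [zero_add] at hfin
  refine hfin.congr fun k => ?_
  simp only [h, map_sub, Pi.sub_apply, avgStep_pow_const hα1]
  ring

/-- Expected mass at which a walk started at `c` with mass `R - p` first has mass
at least `r` of its position. -/
def meanMass (α : V → ℝ) (g : V → K) (r : K → ℕ) (R p : ℕ) (c : K) : ℝ :=
  (R : ℝ) - p + ∑ k ∈ Finset.range p,
    (avgStep α g ^ k) (fun x => if (R : ℤ) - p + k < r x then 1 else 0) c

theorem avgStep_pow_indicator_eq_zero (α : V → ℝ) {g : V → K} {r : K → ℕ}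
    (hr : ∀ c i, r (c + g i) ≤ r c + 1) (k : ℕ) {n : ℤ} {c : K} (hc : (r c : ℤ) ≤ n) :
    (avgStep α g ^ k) (fun x => if n + k < r x then 1 else 0) c = 0 := by
  induction k generalizing n c with
  | zero => simpa using hc
  | succ k ih =>
    rw [avgStep_pow_succ_apply]
    refine Finset.sum_eq_zero fun i _ => ?_
    have := ih (n := n + 1) (c := c + g i) (by have := hr c i; omega)
    rw [show (n + 1 + (k : ℤ)) = n + ((k + 1 : ℕ) : ℤ) by push_cast; ring] at this
    rw [this, mul_zero]

theorem meanMass_of_le (α : V → ℝ) {g : V → K} {r : K → ℕ}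
    (hr : ∀ c i, r (c + g i) ≤ r c + 1) {R p : ℕ} {c : K} (hc : (r c : ℤ) ≤ R - p) :
    meanMass α g r R p c = R - p := by
  rw [meanMass, Finset.sum_eq_zero, add_zero]
  exact fun k _ => avgStep_pow_indicator_eq_zero α hr k hc

theorem meanMass_of_lt {α : V → ℝ} (hα : ∑ i, α i = 1) (g : V → K) {r : K → ℕ}
    {R p : ℕ} {c : K} (hc : (R : ℤ) - (p + 1 : ℕ) < r c) :
    meanMass α g r R (p + 1) c = ∑ i, α i * meanMass α g r R p (c + g i) := by
  simp only [meanMass, mul_add, Finset.sum_add_distrib, ← Finset.sum_mul, hα, one_mul]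
  rw [Finset.sum_range_succ']
  simp only [avgStep_pow_succ_apply, Finset.mul_sum]
  rw [Finset.sum_comm]
  have h1 : ∀ k : ℕ, (R : ℤ) - (p + 1 : ℕ) + (k + 1 : ℕ) = R - p + k := fun k => by
    push_cast; ring
  simp only [h1, pow_zero, Module.End.one_apply, Nat.cast_zero, add_zero, if_pos hc]
  push_cast
  ring

theorem tendsto_meanMass [Fintype K] {α : V → ℝ} (hα : ∀ i, 0 < α i) (hα1 : ∑ i, α i = 1)
    {g : V → K} {z : V} (hz : g z = 0) (hg : ∀ c, ∃ n : V → ℤ, c = ∑ i, n i • g i)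
    {r : K → ℕ} {R : ℕ} (hR : ∀ c, r c ≤ R) (c : K) :
    Tendsto (fun p => meanMass α g r R p c) atTop
      (nhds ((∑ d, (r d : ℝ)) / Fintype.card K)) := by
  have h1 : ∀ᶠ p in atTop, meanMass α g r R p c = ∑ k ∈ Finset.range R,
      (avgStep α g ^ (p - 1 - k)) (fun x => if R - 1 - k < r x then 1 else 0) c := by
    filter_upwards [eventually_ge_atTop R] with p hp
    obtain ⟨m, rfl⟩ := Nat.exists_eq_add_of_le hp
    rw [meanMass, ← Finset.sum_range_reflect, Finset.sum_range_add]
    have h2 : ∀ k ∈ Finset.range m, (avgStep α g ^ (R + m - 1 - (R + k)))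
        (fun x => if (R : ℤ) - (R + m : ℕ) + (R + m - 1 - (R + k) : ℕ) < r x then 1 else 0) c
          = (1 : ℝ) := fun k hk => by
      have hk := Finset.mem_range.1 hk
      have : ∀ x, (R : ℤ) - (R + m : ℕ) + (R + m - 1 - (R + k) : ℕ) < r x := fun x => by omega
      simp only [this, if_true, avgStep_pow_const hα1]
    rw [Finset.sum_congr rfl h2]
    have h3 : ∀ k ∈ Finset.range R, (avgStep α g ^ (R + m - 1 - k))
        (fun x => if (R : ℤ) - (R + m : ℕ) + (R + m - 1 - k : ℕ) < r x then (1 : ℝ) else 0) c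
        = (avgStep α g ^ (R + m - 1 - k)) (fun x => if R - 1 - k < r x then 1 else 0) c :=
      fun k hk => by
        have hk := Finset.mem_range.1 hk
        have : ∀ x, ((R : ℤ) - (R + m : ℕ) + (R + m - 1 - k : ℕ) < r x) ↔ R - 1 - k < r x :=
          fun x => by omega
        simp only [this]
    rw [Finset.sum_congr rfl h3]
    simp
  have h4 : (∑ d, (r d : ℝ)) / Fintype.card K = ∑ k ∈ Finset.range R,
      (∑ d, if R - 1 - k < r d then (1 : ℝ) else 0) / Fintype.card K := by
    rw [← Finset.sum_div, Finset.sum_comm]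
    congr 1
    refine Finset.sum_congr rfl fun d _ => ?_
    rw [Finset.sum_range_reflect (fun j => if j < r d then (1 : ℝ) else 0), Finset.sum_boole]
    congr 1
    rw [show (Finset.range R).filter (fun j => j < r d) = Finset.range (r d) by
      ext j
      have := hR d
      simp only [Finset.mem_filter, Finset.mem_range]
      omega, Finset.card_range]
  rw [h4]
  refine Tendsto.congr' (h1.mono fun _ h => h.symm) (tendsto_finsetSum _ fun k _ => ?_)
  refine (tendsto_avgStep_pow hα hα1 hz hg _ c).comp ?_
  exact (tendsto_sub_atTop_nat k).comp (tendsto_sub_atTop_nat 1)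

end Walk

/-! ### Threshold words -/

theorem hasSum_list {f : List V → ℝ} {a : V → ℝ} (h0 : f [] = 0)
    (h : ∀ i, HasSum (fun w => f (i :: w)) (a i)) : HasSum f (∑ i, a i) := by
  have h1 : ∀ i, HasSum (fun w : List V => if w.head? = some i then f w else 0) (a i) := by
    intro i
    refine ((List.cons_injective (a := i)).hasSum_iff fun w hw => ?_).1 (by
      simpa [Function.comp_def] using h i)
    cases w with
    | nil => simp
    | cons j w =>
      have : j ≠ i := by rintro rfl; exact hw ⟨w, rfl⟩
      simp [this]
  convert hasSum_sum fun i (_ : i ∈ Finset.univ) => h1 i using 2 with w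
  cases w with
  | nil => simpa using h0
  | cons j w => simp

theorem isThresholdWord_nil (A : V → V → ℕ) (s : V → ℤ) :
    IsThresholdWord A s [] ↔ ¬ Stabilizable A s := by
  refine ⟨fun h => h.1, fun h => ⟨h, fun w' hw' hne => ?_⟩⟩
  exact absurd (List.prefix_nil.1 hw') hne

theorem isThresholdWord_cons (A : V → V → ℕ) (s : V → ℤ) (i : V) (w : List V) :
    IsThresholdWord A s (i :: w) ↔
      Stabilizable A s ∧ IsThresholdWord A (closedAdd A i s) w := by
  constructor
  · rintro ⟨h, hp⟩
    refine ⟨hp [] (List.nil_prefix) (by simp), h, fun w' hw' hne => ?_⟩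
    exact hp (i :: w') ((List.prefix_cons_inj i).2 hw') (by simpa using hne)
  · rintro ⟨hs, h, hp⟩
    refine ⟨h, fun w' hw' hne => ?_⟩
    rcases List.prefix_cons_iff.1 hw' with rfl | ⟨t, rfl, ht⟩
    · exact hs
    · exact hp t ht (by simpa using hne)

theorem hasSum_threshold_of_not_stabilizable {K : Type*} [AddCommGroup K] {A : V → V → ℕ}
    {α : V → ℝ} {q : (V → ℤ) → K} {g : V → K} {r : K → ℕ}
    (hr : ∀ c i, r (c + g i) ≤ r c + 1) {R : ℕ}
    (hstab : ∀ s, Stabilizable A s ↔ totalMass s < r (q s)) {p : ℕ} {s : V → ℤ}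
    (hst : ¬ Stabilizable A s) (hs : totalMass s = R - p) :
    HasSum (fun w => if IsThresholdWord A s w then
      wordProb α w * (totalMass (chain A s w) : ℝ) else 0) (meanMass α g r R p (q s)) := by
  rw [meanMass_of_le α hr (by rw [hstab, not_lt, hs] at hst; exact hst)]
  convert hasSum_single (f := fun w => if IsThresholdWord A s w then
    wordProb α w * (totalMass (chain A s w) : ℝ) else 0) [] (fun w hw => ?_) using 1
  · rw [if_pos ((isThresholdWord_nil A s).2 hst)]
    simp [wordProb, chain, hs]
  · cases w with
    | nil => exact absurd rfl hw
    | cons i w => simp [isThresholdWord_cons, hst]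

theorem hasSum_threshold {K : Type*} [AddCommGroup K] {A : V → V → ℕ} {α : V → ℝ}
    (hα : ∑ i, α i = 1) {q : (V → ℤ) → K} {g : V → K}
    (hq : ∀ i s, q (closedAdd A i s) = q s + g i) {r : K → ℕ}
    (hr : ∀ c i, r (c + g i) ≤ r c + 1) {R : ℕ} (hR : ∀ c, r c ≤ R)
    (hstab : ∀ s, Stabilizable A s ↔ totalMass s < r (q s)) {p : ℕ} {s : V → ℤ}
    (hs : totalMass s = R - p) :
    HasSum (fun w => if IsThresholdWord A s w then
      wordProb α w * (totalMass (chain A s w) : ℝ) else 0) (meanMass α g r R p (q s)) := by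
  induction p generalizing s with
  | zero =>
    refine hasSum_threshold_of_not_stabilizable hr hstab (fun h => ?_) hs
    have := (hstab s).1 h
    have := hR (q s)
    omega
  | succ p ih =>
    by_cases hst : Stabilizable A s
    · rw [meanMass_of_lt hα g (hs ▸ (hstab s).1 hst)]
      refine hasSum_list (by simp [isThresholdWord_nil, hst]) fun i => ?_
      have hm : totalMass (closedAdd A i s) = R - p := by
        obtain ⟨v, hv⟩ := closedAdd_eq A i s
        rw [hv, totalMass_add, totalMass_add, totalMass_lap, totalMass_delta, hs]
        push_cast
        ring
      have h := (ih hm).mul_left (α i)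
      rw [hq] at h
      have hf : ∀ w, (if IsThresholdWord A s (i :: w) then
          wordProb α (i :: w) * (totalMass (chain A s (i :: w)) : ℝ) else 0) =
          α i * if IsThresholdWord A (closedAdd A i s) w then
            wordProb α w * (totalMass (chain A (closedAdd A i s) w) : ℝ) else 0 := fun w => by
        simp only [isThresholdWord_cons, hst, true_and, mul_ite, mul_zero]
        simp only [wordProb, List.map_cons, List.prod_cons, mul_assoc]
        rfl
      simpa only [hf] using h
    · exact hasSum_threshold_of_not_stabilizable hr hstab hst hs

/-! ### The sandpile group -/

/-- Sandpiles equivalent to `0` modulo topplings and chips at `z`. -/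
def relations (A : V → V → ℕ) (z : V) : AddSubgroup (V → ℤ) :=
  (lapHom A).range ⊔ AddSubgroup.zmultiples (delta z)

/-- The sandpile group of `A` with sink `z`. -/
abbrev SandpileGroup (A : V → V → ℕ) (z : V) : Type _ := (V → ℤ) ⧸ relations A z

/-- The class of a sandpile in the sandpile group. -/
def toClass (A : V → V → ℕ) (z : V) : (V → ℤ) →+ SandpileGroup A z :=
  QuotientAddGroup.mk' (relations A z)

theorem toClass_eq_iff (A : V → V → ℕ) (z : V) (s t : V → ℤ) :
    toClass A z s = toClass A z t ↔
      ∃ m : ℤ, ∃ v : V → ℤ, ∀ j, t j = s j + m * delta z j + lap A v j := by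
  rw [toClass, QuotientAddGroup.mk'_apply, QuotientAddGroup.mk'_apply, QuotientAddGroup.eq,
    relations, AddSubgroup.mem_sup]
  constructor
  · rintro ⟨_, ⟨v, rfl⟩, _, ⟨m, rfl⟩, h⟩
    refine ⟨m, v, fun j => ?_⟩
    have h' : lap A v j + m * delta z j = -s j + t j := congrFun h j
    linarith
  · rintro ⟨m, v, h⟩
    refine ⟨_, ⟨v, rfl⟩, _, ⟨m, rfl⟩, ?_⟩
    ext j
    change lap A v j + m * delta z j = -s j + t j
    linarith [h j]

theorem toClass_delta_self (A : V → V → ℕ) (z : V) : toClass A z (delta z) = 0 := by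
  rw [← map_zero (toClass A z), toClass_eq_iff]
  exact ⟨-1, 0, fun j => by simp [lap_zero]⟩

theorem toClass_lap (A : V → V → ℕ) (z : V) (v : V → ℤ) : toClass A z (lap A v) = 0 := by
  rw [← map_zero (toClass A z), toClass_eq_iff]
  exact ⟨0, -v, fun j => by simp [lap_neg]⟩

theorem toClass_closedAdd (A : V → V → ℕ) (z i : V) (s : V → ℤ) :
    toClass A z (closedAdd A i s) = toClass A z s + toClass A z (delta i) := by
  obtain ⟨v, hv⟩ := closedAdd_eq A i s
  rw [hv, map_add, map_add, toClass_lap, add_zero]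

theorem exists_eq_sum_zsmul (A : V → V → ℕ) (z : V) (c : SandpileGroup A z) :
    ∃ n : V → ℤ, c = ∑ i, n i • toClass A z (delta i) := by
  obtain ⟨s, rfl⟩ := QuotientAddGroup.mk'_surjective (relations A z) c
  refine ⟨s, ?_⟩
  simp only [← map_zsmul, ← map_sum]
  change toClass A z s = _
  congr 1
  ext j
  simp [delta]

theorem finite_zRec {A : V → V → ℕ} (hEul : Eulerian A) {z : V} :
    Finite {ρ : V → ℤ // ZRec A z ρ} :=
  (Set.finite_Icc (0 : V → ℤ) fun i => (deg A i : ℤ)).subset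
    fun _ hρ => ⟨ZRec.nonneg hEul hρ, ZRec.le_deg hρ⟩

/-- Each class of the sandpile group contains exactly one `z`-recurrent sandpile. -/
def recEquiv {A : V → V → ℕ} (hEul : Eulerian A) (hConn : Connected A) (z : V) :
    {ρ : V → ℤ // ZRec A z ρ} ≃ SandpileGroup A z :=
  Equiv.ofBijective (fun ρ => toClass A z ρ.1) <| by
    constructor
    · intro ρ ρ' h
      obtain ⟨m, v, h⟩ := (toClass_eq_iff A z _ _).1 h
      exact Subtype.ext (ρ.2.eq_of_equiv hEul ρ'.2 h).symm
    · intro c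
      obtain ⟨s, rfl⟩ := QuotientAddGroup.mk'_surjective (relations A z) c
      obtain ⟨ρ, m, v, hρ, -, h⟩ := exists_zDecomp hEul hConn z s
      exact ⟨⟨ρ, hρ⟩, (toClass_eq_iff A z _ _).2 ⟨m, v, h⟩⟩

theorem toClass_recEquiv_symm {A : V → V → ℕ} (hEul : Eulerian A) (hConn : Connected A) (z : V)
    (c : SandpileGroup A z) : toClass A z ((recEquiv hEul hConn z).symm c).1 = c :=
  (recEquiv hEul hConn z).apply_symm_apply c

/-- The mass of the `z`-recurrent representative of a class. -/
def recMass {A : V → V → ℕ} (hEul : Eulerian A) (hConn : Connected A) (z : V)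
    (c : SandpileGroup A z) : ℕ :=
  (totalMass ((recEquiv hEul hConn z).symm c).1).toNat

theorem recMass_eq {A : V → V → ℕ} (hEul : Eulerian A) (hConn : Connected A) (z : V)
    (c : SandpileGroup A z) :
    (recMass hEul hConn z c : ℤ) = totalMass ((recEquiv hEul hConn z).symm c).1 :=
  Int.toNat_of_nonneg <| Finset.sum_nonneg fun i _ =>
    ((recEquiv hEul hConn z).symm c).2.nonneg hEul i

theorem stabilizable_iff_lt_recMass {A : V → V → ℕ} (hEul : Eulerian A) (hConn : Connected A)
    (z : V) (s : V → ℤ) :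
    Stabilizable A s ↔ totalMass s < recMass hEul hConn z (toClass A z s) := by
  rw [recMass_eq]
  obtain ⟨m, v, h⟩ := (toClass_eq_iff A z _ _).1 (toClass_recEquiv_symm hEul hConn z (toClass A z s))
  have hρ := ((recEquiv hEul hConn z).symm (toClass A z s)).2
  set ρ := ((recEquiv hEul hConn z).symm (toClass A z s)).1
  have hs : s = ρ + m • delta z + lap A v := by
    ext j
    rw [h j]
    rfl
  have hm : totalMass (m • delta z) = m := by
    simp [totalMass, delta]
  have hmass : totalMass s = totalMass ρ + m := by
    conv_lhs => rw [hs]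
    rw [totalMass_add, totalMass_add, totalMass_lap, hm, add_zero]
  rw [hmass]
  conv_lhs => rw [hs]
  rw [stabilizable_add_lap_iff hEul]
  constructor
  · intro hst
    by_contra hneg
    refine hρ.not_stabilizable hEul (hst.mono hEul fun i => ?_)
    have : 0 ≤ m * delta z i := mul_nonneg (by linarith) (by simp only [delta]; split_ifs <;> simp)
    change ρ i ≤ ρ i + m * delta z i
    linarith
  · intro hlt
    refine (stabilizable_iff hEul _).2 ⟨0, fun i => ?_⟩
    rw [lap_zero, add_zero]
    change ρ i + m * delta z i ≤ _
    by_cases hi : i = z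
    · subst hi
      rw [hρ.1]
      simp only [delta, if_true]
      linarith
    · simpa [delta, hi] using hρ.2.1 i hi

theorem recMass_add_le {A : V → V → ℕ} (hEul : Eulerian A) (hConn : Connected A) (z : V)
    (c : SandpileGroup A z) (i : V) :
    recMass hEul hConn z (c + toClass A z (delta i)) ≤ recMass hEul hConn z c + 1 := by
  have hρ := ((recEquiv hEul hConn z).symm c).2
  have hc := toClass_recEquiv_symm hEul hConn z c
  have hm := recMass_eq hEul hConn z c
  set ρ := ((recEquiv hEul hConn z).symm c).1
  have h : ¬ Stabilizable A (ρ + delta i) := fun h =>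
    hρ.not_stabilizable hEul (h.mono hEul fun j => by
      simp only [Pi.add_apply, delta]
      split_ifs <;> simp)
  rw [stabilizable_iff_lt_recMass hEul hConn z, map_add, hc, totalMass_add, totalMass_delta,
    ← hm] at h
  omega

end ThresholdState

open ThresholdState in
/-- Conjecture of Poghosyan–Poghosyan–Priezzhev–Ruelle: the threshold density
`ζ_τ(s₀) = E_{s₀}[|s_τ|]/#V` converges to the stationary density
`ζ_s = (1/κ)·Σ_{ρ ∈ Rec(z)} |ρ|/#V` as `|s₀| → -∞`. -/
theorem statement_4 {V : Type*} [Fintype V] [DecidableEq V]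
    (A : V → V → ℕ) (hEul : Eulerian A) (hConn : Connected A)
    (α : V → ℝ) (hαpos : ∀ j, 0 < α j) (hαsum : ∑ j, α j = 1) (z : V) :
    ∀ ε : ℝ, 0 < ε → ∃ K : ℤ, K < 0 ∧ ∀ s0 : V → ℤ, totalMass s0 < K →
      |thresholdExp A α s0 (fun w => (totalMass (chain A s0 w) : ℝ)) / (Fintype.card V : ℝ)
        - (1 / (kappa A z : ℝ)) *
            ∑' ρ : {ρ : V → ℤ // ZRec A z ρ}, (totalMass ρ.1 : ℝ) / (Fintype.card V : ℝ)|
      ≤ ε := by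
  intro ε hε
  have hV : 0 < Fintype.card V := Fintype.card_pos_iff.2 ⟨z⟩
  have := finite_zRec hEul (z := z)
  have : Finite (SandpileGroup A z) := Finite.of_equiv _ (recEquiv hEul hConn z)
  have := Fintype.ofFinite (SandpileGroup A z)
  have := Fintype.ofFinite {ρ : V → ℤ // ZRec A z ρ}
  let g : V → SandpileGroup A z := fun i => toClass A z (delta i)
  let r := recMass hEul hConn z
  let R : ℕ := ∑ c, r c
  have hR : ∀ c, r c ≤ R := fun c =>
    Finset.single_le_sum (f := r) (fun _ _ => Nat.zero_le _) (Finset.mem_univ c)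
  have htarget : (1 / (kappa A z : ℝ)) *
      ∑' ρ : {ρ : V → ℤ // ZRec A z ρ}, (totalMass ρ.1 : ℝ) / (Fintype.card V : ℝ)
      = (∑ d, (r d : ℝ)) / Fintype.card (SandpileGroup A z) / Fintype.card V := by
    rw [tsum_fintype, kappa, Nat.card_congr (recEquiv hEul hConn z), Nat.card_eq_fintype_card,
      ← Finset.sum_div, ← Equiv.sum_comp (recEquiv hEul hConn z) fun d => (r d : ℝ)]
    have : ∀ ρ : {ρ : V → ℤ // ZRec A z ρ},
        (r (recEquiv hEul hConn z ρ) : ℝ) = totalMass ρ.1 := fun ρ => by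
      have h := recMass_eq hEul hConn z (recEquiv hEul hConn z ρ)
      rw [Equiv.symm_apply_apply] at h
      exact_mod_cast h
    simp only [this]
    ring
  have hlim : ∀ᶠ p in atTop, ∀ c, |meanMass α g r R p c / Fintype.card V
      - (∑ d, (r d : ℝ)) / Fintype.card (SandpileGroup A z) / Fintype.card V| ≤ ε := by
    rw [eventually_all]
    intro c
    have h := (tendsto_meanMass hαpos hαsum (g := g) (toClass_delta_self A z)
      (exists_eq_sum_zsmul A z) hR c).div_const (Fintype.card V : ℝ)
    filter_upwards [Metric.tendsto_nhds.1 h ε hε] with p hp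
    rw [Real.dist_eq] at hp
    exact hp.le
  obtain ⟨P, hP⟩ := eventually_atTop.1 hlim
  refine ⟨-(P : ℤ) - 1, by omega, fun s hs => ?_⟩
  obtain ⟨p, hp⟩ := Int.eq_ofNat_of_zero_le (a := (R : ℤ) - totalMass s) (by omega)
  have h := hasSum_threshold hαsum (q := toClass A z) (g := g)
    (fun i s => toClass_closedAdd A z i s) (recMass_add_le hEul hConn z) hR
    (stabilizable_iff_lt_recMass hEul hConn z) (p := p) (s := s) (by linarith)
  rw [thresholdExp, h.tsum_eq, htarget]
  exact hP p (by omega) _
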